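/- arXiv:1711.07356 — 3 statements merged into one kernel-verified Lean document; each statement's English description precedes it below -/
import Mathlib

section
/- Equivalence of the MILP formulation of ReLU: Let l < 0 < u be real numbers and let x be a real number with l ≤ x ≤ u. Then for any real number y, one has y = max(x, 0) if and only if there exists a ∈ {0, 1} such that y ≤ x − l·(1 − a), y ≥ x, y ≤ u·a, and y ≥ 0. -/
/-- Equivalence of the MILP formulation of an unstable ReLU: for `l < 0 < u`
and `l ≤ x ≤ u`, one has `y = max x 0` iff there exists a binary `a`
satisfying the four linear constraints. -/
theorem relu_milp_iff (x y l u : ℝ)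
    (hl : l < 0) (hu : 0 < u) (hlx : l ≤ x) (hxu : x ≤ u) :
    y = max x 0 ↔
      ∃ a : ℝ, (a = 0 ∨ a = 1) ∧
        y ≤ x - l * (1 - a) ∧ y ≥ x ∧ y ≤ u * a ∧ y ≥ 0 := by
  constructor
  · rintro rfl
    rcases le_total 0 x with hx | hx
    · rw [max_eq_left hx]
      exact ⟨1, Or.inr rfl, by linarith, le_rfl, by linarith, hx⟩
    · rw [max_eq_right hx]
      exact ⟨0, Or.inl rfl, by linarith, hx, by linarith, le_rfl⟩
  · rintro ⟨a, rfl | rfl, hyl, hyx, hyu, hy⟩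
    · rw [max_eq_right] <;> linarith
    · rw [max_eq_left] <;> linarith
end

section
/- Sharpness of the ReLU formulation: Let l < 0 < u be real numbers. The set of points (x, y) ∈ ℝ² for which there exists a ∈ [0, 1] satisfying l ≤ x ≤ u, y ≤ x − l·(1 − a), y ≥ x, y ≤ u·a, and y ≥ 0 is exactly the convex hull of the graph {(x, max(x, 0)) : l ≤ x ≤ u} of the ReLU function restricted to [l, u]. -/
/-- A point of the relaxation is the convex combination of `(l, 0)`, `(u, u)` and `(0, 0)` with
weights `(y - x) / (-l)`, `y / u` and the remainder. -/
theorem mem_convexHull_relu_graph {l u x y a : ℝ} (hl : l < 0) (hu : 0 < u)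
    (hyl : y ≤ x - l * (1 - a)) (hxy : x ≤ y) (hyu : y ≤ u * a) (hy : 0 ≤ y) :
    (x, y) ∈ convexHull ℝ {p : ℝ × ℝ | l ≤ p.1 ∧ p.1 ≤ u ∧ p.2 = max p.1 0} := by
  set S := {p : ℝ × ℝ | l ≤ p.1 ∧ p.1 ≤ u ∧ p.2 = max p.1 0}
  have hl0 : ((l, 0) : ℝ × ℝ) ∈ S := ⟨le_rfl, (hl.trans hu).le, (max_eq_right hl.le).symm⟩
  have huu : ((u, u) : ℝ × ℝ) ∈ S := ⟨(hl.trans hu).le, le_rfl, (max_eq_left hu.le).symm⟩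
  have h00 : ((0, 0) : ℝ × ℝ) ∈ S := ⟨hl.le, hu.le, (max_self 0).symm⟩
  have hv : (y - x) / (-l) ≤ 1 - a := by
    rw [div_le_iff₀ (by linarith)]
    linarith
  have hw : y / u ≤ a := by
    rw [div_le_iff₀ hu]
    linarith
  have hcomb := (convex_convexHull ℝ S).sum_mem (t := Finset.univ)
    (w := ![(y - x) / (-l), y / u, 1 - (y - x) / (-l) - y / u])
    (z := ![(l, 0), (u, u), (0, 0)])
    (by
      intro i _
      fin_cases i
      · exact div_nonneg (by linarith) (by linarith)
      · exact div_nonneg hy hu.le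
      · change 0 ≤ 1 - (y - x) / (-l) - y / u
        linarith)
    (by simp [Fin.sum_univ_three])
    (by
      intro i _
      apply subset_convexHull
      fin_cases i
      exacts [hl0, huu, h00])
  convert hcomb using 1
  have hl' := hl.ne
  have hu' := hu.ne'
  ext
  · simp [Fin.sum_univ_three]
    field_simp
    ring
  · simp [Fin.sum_univ_three]
    field_simp

/-- The projection of the relaxation to the `(x, y)`-plane is convex. -/
theorem convex_relu_relaxation (l u : ℝ) :
    Convex ℝ {p : ℝ × ℝ | ∃ a : ℝ, 0 ≤ a ∧ a ≤ 1 ∧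
        l ≤ p.1 ∧ p.1 ≤ u ∧
        p.2 ≤ p.1 - l * (1 - a) ∧ p.2 ≥ p.1 ∧ p.2 ≤ u * a ∧ p.2 ≥ 0} := by
  rintro ⟨x, y⟩ ⟨a, h1, h2, h3, h4, h5, h6, h7, h8⟩ ⟨x', y'⟩ ⟨a', k1, k2, k3, k4, k5, k6, k7, k8⟩
    s t hs ht hst
  obtain rfl : t = 1 - s := by linarith
  dsimp only at *
  refine ⟨s * a + (1 - s) * a', ?_⟩
  simp only [Prod.smul_mk, Prod.mk_add_mk, smul_eq_mul]
  refine ⟨by positivity, ?_, ?_, ?_, ?_, ?_, ?_, by positivity⟩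
  · linarith [mul_le_mul_of_nonneg_left h2 hs, mul_le_mul_of_nonneg_left k2 ht]
  · linarith [mul_le_mul_of_nonneg_left h3 hs, mul_le_mul_of_nonneg_left k3 ht]
  · linarith [mul_le_mul_of_nonneg_left h4 hs, mul_le_mul_of_nonneg_left k4 ht]
  · linarith [mul_le_mul_of_nonneg_left h5 hs, mul_le_mul_of_nonneg_left k5 ht]
  · linarith [mul_le_mul_of_nonneg_left h6 hs, mul_le_mul_of_nonneg_left k6 ht]
  · linarith [mul_le_mul_of_nonneg_left h7 hs, mul_le_mul_of_nonneg_left k7 ht]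

/-- Sharpness of the ReLU formulation: for `l < 0 < u`, the LP relaxation of
the MILP formulation of the ReLU describes exactly the convex hull of the
graph of `x ↦ max x 0` over `[l, u]`. -/
theorem relu_milp_relaxation_sharp (l u : ℝ) (hl : l < 0) (hu : 0 < u) :
    {p : ℝ × ℝ | ∃ a : ℝ, 0 ≤ a ∧ a ≤ 1 ∧
        l ≤ p.1 ∧ p.1 ≤ u ∧
        p.2 ≤ p.1 - l * (1 - a) ∧ p.2 ≥ p.1 ∧ p.2 ≤ u * a ∧ p.2 ≥ 0} =
      convexHull ℝ {p : ℝ × ℝ | l ≤ p.1 ∧ p.1 ≤ u ∧ p.2 = max p.1 0} := by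
  apply Set.Subset.antisymm
  · rintro ⟨x, y⟩ ⟨a, -, -, -, -, hyl, hxy, hyu, hy⟩
    exact mem_convexHull_relu_graph hl hu hyl hxy hyu hy
  · refine convexHull_min ?_ (convex_relu_relaxation l u)
    rintro ⟨x, y⟩ ⟨hlx, hxu, hy⟩
    dsimp only at hlx hxu hy
    subst hy
    rcases le_total x 0 with hx | hx
    · refine ⟨0, ?_⟩
      simp only [max_eq_right hx]
      refine ⟨?_, ?_, ?_, ?_, ?_, ?_, ?_, ?_⟩ <;> linarith
    · refine ⟨1, ?_⟩
      simp only [max_eq_left hx]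
      refine ⟨?_, ?_, ?_, ?_, ?_, ?_, ?_, ?_⟩ <;> linarith
end

section
/- Soundness of the MILP formulation of the maximum function: Let m ≥ 1 and let x₁, …, x_m, y be real numbers, let l₁, …, l_m and u₁, …, u_m be real numbers, and for each i set u_{max,−i} = max over j ≠ i of u_j. Suppose a₁, …, a_m ∈ {0, 1} with Σᵢ aᵢ = 1, and for every i the constraints y ≤ x_i + (1 − a_i)·(u_{max,−i} − l_i) and y ≥ x_i hold. Then y = max(x₁, …, x_m). -/
/-- Soundness of the MILP formulation of the maximum function: if the binary
indicator variables `a i` sum to `1` and the linear constraints hold, then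
`y = max (x 1, …, x m)`, where `u_{max,-i}` denotes the maximum of `u j`
over `j ≠ i`. -/
theorem max_milp_sound (m : ℕ) (hm : 1 ≤ m)
    (x l u : Fin m → ℝ) (y : ℝ) (a : Fin m → ℝ)
    (ha : ∀ i, a i = 0 ∨ a i = 1)
    (hsum : ∑ i, a i = 1)
    (hupper : ∀ i, y ≤ x i +
      (1 - a i) * ((⨆ j : {j : Fin m // j ≠ i}, u (j : Fin m)) - l i))
    (hlower : ∀ i, y ≥ x i) :
    y = Finset.univ.sup' ⟨⟨0, hm⟩, Finset.mem_univ _⟩ x := by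
  obtain ⟨i, -, hi⟩ := Finset.exists_ne_zero_of_sum_ne_zero (hsum.trans_ne one_ne_zero)
  have hyi : y ≤ x i := by simpa [(ha i).resolve_left hi] using hupper i
  exact le_antisymm (hyi.trans (Finset.le_sup' x (Finset.mem_univ i)))
    (Finset.sup'_le _ _ fun j _ => hlower j)
end
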